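/- Let b > 0 and p > 1 be real numbers, and define d(t) := (1 + t) e^{−(b/2)t}. Then there exists a constant C > 0 such that for every t ≥ 0 one has ∫₀ᵗ d(t−s) (d(s))^p ds ≤ C d(t), i.e. ∫₀ᵗ (1 + t − s) e^{−(b/2)(t−s)} ((1 + s) e^{−(b/2)s})^p ds ≤ C (1 + t) e^{−(b/2)t}. -/

import Mathlib

open MeasureTheory intervalIntegral

lemma one_add_le_mul_exp {c s : ℝ} (hc : 0 < c) (hs : 0 ≤ s) :
    1 + s ≤ (1 + 1 / c) * Real.exp (c * s) := by
  have h : s = 1 / c * (c * s) := by field_simp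
  calc 1 + s ≤ (1 + 1 / c) * (c * s + 1) := by
        have : 0 ≤ c * s := by positivity
        have : 0 < 1 / c := by positivity
        nlinarith
    _ ≤ _ := by gcongr; exact Real.add_one_le_exp _

lemma integral_exp_neg_mul_le {r : ℝ} (hr : 0 < r) (t : ℝ) :
    ∫ s in (0:ℝ)..t, Real.exp (-r * s) ≤ 1 / r := by
  rw [integral_comp_mul_left (fun x ↦ Real.exp x) (neg_ne_zero.mpr hr.ne'), integral_exp,
    smul_eq_mul, mul_zero, Real.exp_zero, inv_neg, one_div]
  have : 0 < r⁻¹ * Real.exp (-r * t) := by positivity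
  linarith

theorem duhamel_integral_threshold_decay (b p : ℝ) (hb : 0 < b) (hp : 1 < p) :
    ∃ C : ℝ, 0 < C ∧ ∀ t : ℝ, 0 ≤ t →
      ∫ s in (0:ℝ)..t,
          (1 + (t - s)) * Real.exp (-(b / 2) * (t - s)) * ((1 + s) * Real.exp (-(b / 2) * s)) ^ p
        ≤ C * ((1 + t) * Real.exp (-(b / 2) * t)) := by
  have hp0 : 0 < p := by linarith
  -- `r` is half of the surplus decay rate `(p - 1) * (b / 2)`
  obtain ⟨r, hr⟩ : ∃ r, r = (p - 1) * b / 4 := ⟨_, rfl⟩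
  have hr0 : 0 < r := by
    rw [hr]
    have : 0 < p - 1 := by linarith
    positivity
  have hc : 0 < r / p := by positivity
  obtain ⟨M, hM⟩ : ∃ M, M = 1 + 1 / (r / p) := ⟨_, rfl⟩
  have hM0 : 0 < M := by rw [hM]; positivity
  refine ⟨M ^ p * (1 / r), by positivity, fun t ht ↦ ?_⟩
  have hpoint : ∀ s ∈ Set.Icc 0 t,
      (1 + (t - s)) * Real.exp (-(b / 2) * (t - s)) * ((1 + s) * Real.exp (-(b / 2) * s)) ^ p
        ≤ M ^ p * ((1 + t) * Real.exp (-(b / 2) * t)) * Real.exp (-r * s) := by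
    rintro s ⟨hs, hst⟩
    have hts : 0 ≤ t - s := by linarith
    calc _ ≤ (1 + t) * Real.exp (-(b / 2) * (t - s)) *
          (M * Real.exp (r / p * s) * Real.exp (-(b / 2) * s)) ^ p := by
          have := one_add_le_mul_exp hc hs
          rw [← hM] at this
          gcongr
          linarith
      _ = (1 + t) * M ^ p * (Real.exp (-(b / 2) * (t - s)) *
          Real.exp ((r / p * s + -(b / 2) * s) * p)) := by
          rw [mul_assoc M, ← Real.exp_add, Real.mul_rpow hM0.le (Real.exp_pos _).le,
            ← Real.exp_mul]
          ring
      _ = (1 + t) * M ^ p * (Real.exp (-(b / 2) * t) * Real.exp (-r * s)) := by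
          rw [← Real.exp_add, ← Real.exp_add]
          congr 2
          field_simp
          rw [hr]
          ring
      _ = _ := by ring
  calc _ ≤ ∫ s in (0:ℝ)..t,
        M ^ p * ((1 + t) * Real.exp (-(b / 2) * t)) * Real.exp (-r * s) := by
        refine integral_mono_on ht ?_ ?_ hpoint
        · refine Continuous.intervalIntegrable (Continuous.mul (by fun_prop) ?_) _ _
          exact Continuous.rpow_const (by fun_prop) fun _ ↦ Or.inr hp0.le
        · exact Continuous.intervalIntegrable (by fun_prop) _ _
    _ ≤ M ^ p * ((1 + t) * Real.exp (-(b / 2) * t)) * (1 / r) := by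
        rw [intervalIntegral.integral_const_mul]
        gcongr
        exact integral_exp_neg_mul_le hr0 t
    _ = _ := by ring
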